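/- arXiv:2008.04192 — 3 statements merged into one kernel-verified Lean document; each statement's English description precedes it below -/
import Mathlib

section
/- Let F be a field of characteristic different from 2, G a group, and ρ̄ : G → GL₂(F) a group homomorphism. Let Z denote the G-submodule of Ad(ρ̄) consisting of scalar matrices (on which G acts trivially). Then the map H¹(G, Z) → H¹(G, Ad(ρ̄)) induced by the inclusion Z ⊆ Ad(ρ̄) is injective. -/
open Matrix

/-- For `F` of characteristic `≠ 2` and `ρ0 : G → GL₂(F)`, the map
`H¹(G, Z) → H¹(G, Ad(ρ0))` induced by the inclusion of the scalar matrices `Z` (with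
trivial `G`-action) is injective.  Concretely: a `Z`-valued 1-cocycle (i.e. an additive
character `z : G → F`, giving the cocycle `g ↦ z(g)•1`) which becomes a coboundary in `Ad`
is itself a coboundary for `Z`, hence zero. -/
theorem h1_scalars_to_ad_injective
    {F : Type*} [Field F] (h2 : (2 : F) ≠ 0) {G : Type*} [Group G]
    (ρ0 : G →* GL (Fin 2) F) (z : G → F)
    (hcoc : ∀ g h : G, z (g * h) = z g + z h)
    (hbdry : ∃ m : Matrix (Fin 2) (Fin 2) F, ∀ g : G,
      z g • (1 : Matrix (Fin 2) (Fin 2) F) =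
        (ρ0 g : Matrix (Fin 2) (Fin 2) F) * m *
            (((ρ0 g)⁻¹ : GL (Fin 2) F) : Matrix (Fin 2) (Fin 2) F) - m) :
    ∀ g : G, z g = 0 := by
  obtain ⟨m, hm⟩ := hbdry
  intro g
  have htr := congrArg trace (hm g)
  rw [trace_sub, trace_units_conj, sub_self, trace_smul, trace_one] at htr
  simpa [h2] using htr
end

section
/- Let l > 3 be a prime, F a field extension of 𝔽_l, G a group, and ρ̄ : G → GL₂(F) a group homomorphism whose image contains SL₂(𝔽_l) (embedded via 𝔽_l ⊆ F). Then for every group homomorphism η : G → Fˣ, every F-linear map φ from the trace-zero matrices Ad⁰(ρ̄) to F satisfying φ(ρ̄(g) m ρ̄(g)⁻¹) = η(g)·φ(m) for all g ∈ G and all trace-zero m is identically zero; that is, H⁰(G, (Ad⁰)*(η)) = 0 for every character twist η. -/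
open Matrix

/-- Let `l > 3` be a prime, `F` a field extension of `𝔽_l`, and
`ρ0 : G → GL₂(F)` a homomorphism whose image contains `SL₂(𝔽_l)`.  Then for every character
`η : G → Fˣ`, every `F`-linear map `φ : Ad⁰(ρ0) → F` satisfying
`φ(ρ0(g) m ρ0(g)⁻¹) = η(g)·φ(m)` for all `g` and all trace-zero `m` is identically zero;
that is, `H⁰(G, (Ad⁰)*(η)) = 0`. -/
theorem h0_ad0_dual_twist_eq_zero
    (l : ℕ) [Fact (Nat.Prime l)] (hl : 3 < l)
    {F : Type*} [Field F] [Algebra (ZMod l) F] {G : Type*} [Group G]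
    (ρ0 : G →* GL (Fin 2) F)
    (hSL : ∀ A : Matrix (Fin 2) (Fin 2) (ZMod l), A.det = 1 →
      ∃ g : G, (ρ0 g : Matrix (Fin 2) (Fin 2) F) = A.map (algebraMap (ZMod l) F))
    (η : G →* Fˣ)
    (φ : ↥(LinearMap.ker (Matrix.traceLinearMap (Fin 2) F F)) →ₗ[F] F)
    (hφ : ∀ (g : G) (m : ↥(LinearMap.ker (Matrix.traceLinearMap (Fin 2) F F))),
      φ ⟨(ρ0 g : Matrix (Fin 2) (Fin 2) F) * (m : Matrix (Fin 2) (Fin 2) F) *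
            (((ρ0 g)⁻¹ : GL (Fin 2) F) : Matrix (Fin 2) (Fin 2) F), by
          have hm : Matrix.trace (m : Matrix (Fin 2) (Fin 2) F) = 0 := m.2
          simp only [LinearMap.mem_ker, Matrix.traceLinearMap_apply]
          rw [Matrix.trace_mul_cycle, Units.inv_mul, Matrix.one_mul, hm]⟩ =
        (η g : F) * φ m) :
    φ = 0 := by
  have two_ne : (2 : F) ≠ 0 := by
    have : (2 : ZMod l) ≠ 0 := by
      intro h
      have hdvd : l ∣ 2 := (ZMod.natCast_eq_zero_iff 2 l).mp (by exact_mod_cast h)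
      exact absurd (Nat.le_of_dvd two_pos hdvd) (by omega)
    rw [← map_ofNat (algebraMap (ZMod l) F) 2]
    exact (map_ne_zero (algebraMap (ZMod l) F)).mpr this
  -- Equivariance of `φ`, stated without inverses.
  have conj (g : G) (m m' : ↥(LinearMap.ker (Matrix.traceLinearMap (Fin 2) F F)))
      (h : (ρ0 g : Matrix (Fin 2) (Fin 2) F) * (m : Matrix (Fin 2) (Fin 2) F) =
        (m' : Matrix (Fin 2) (Fin 2) F) * (ρ0 g : Matrix (Fin 2) (Fin 2) F)) :
      φ m' = (η g : F) * φ m := by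
    rw [← hφ g m]
    refine congrArg φ (Subtype.ext ?_)
    change (m' : Matrix (Fin 2) (Fin 2) F) = (ρ0 g : Matrix (Fin 2) (Fin 2) F) *
      (m : Matrix (Fin 2) (Fin 2) F) * (((ρ0 g)⁻¹ : GL (Fin 2) F) : Matrix (Fin 2) (Fin 2) F)
    rw [h, Matrix.mul_assoc, Units.mul_inv, Matrix.mul_one]
  let T (a b c : F) : ↥(LinearMap.ker (Matrix.traceLinearMap (Fin 2) F F)) :=
    ⟨!![a, b; c, -a], by simp [Matrix.trace_fin_two]⟩
  have hT (a b c : F) : φ (T a b c) = a * φ (T 1 0 0) + b * φ (T 0 1 0) + c * φ (T 0 0 1) := by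
    have : T a b c = a • T 1 0 0 + b • T 0 1 0 + c • T 0 0 1 := by
      ext i j
      fin_cases i <;> fin_cases j <;> simp [T]
    simp only [this, map_add, map_smul, smul_eq_mul]
  obtain ⟨u, hu⟩ := hSL !![1, 1; 0, 1] (by simp)
  obtain ⟨v, hv⟩ := hSL !![1, 0; 1, 1] (by simp)
  have u_e := conj u (T 0 1 0) (T 0 1 0) (by
    rw [hu]; ext i j; fin_cases i <;> fin_cases j <;> simp [T, Matrix.mul_apply])
  have u_h := conj u (T 1 0 0) (T 1 (-2) 0) (by
    rw [hu]; ext i j; fin_cases i <;> fin_cases j <;> simp [T, Matrix.mul_apply]; ring)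
  have u_f := conj u (T 0 0 1) (T 1 (-1) 1) (by
    rw [hu]; ext i j; fin_cases i <;> fin_cases j <;> simp [T, Matrix.mul_apply])
  have v_h := conj v (T 1 0 0) (T 1 0 2) (by
    rw [hv]; ext i j; fin_cases i <;> fin_cases j <;> simp [T, Matrix.mul_apply]; ring)
  rw [hT 1 (-2) 0] at u_h
  rw [hT 1 (-1) 1] at u_f
  rw [hT 1 0 2] at v_h
  have e_zero : φ (T 0 1 0) = 0 := by
    have : 2 * φ (T 0 1 0) ^ 2 = 0 := by
      linear_combination φ (T 1 0 0) * u_e - φ (T 0 1 0) * u_h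
    simpa [two_ne] using this
  have h_zero : φ (T 1 0 0) = 0 := by
    rw [e_zero] at u_h u_f
    have : φ (T 1 0 0) ^ 2 = 0 := by
      linear_combination φ (T 1 0 0) * u_f - φ (T 0 0 1) * u_h
    simpa using this
  have f_zero : φ (T 0 0 1) = 0 := by
    simpa [e_zero, h_zero, two_ne] using v_h
  ext m
  have hm : m = T (m.1 0 0) (m.1 0 1) (m.1 1 0) := by
    have htr : m.1 0 0 + m.1 1 1 = 0 := by
      rw [← Matrix.trace_fin_two]
      exact m.2
    ext i j
    fin_cases i <;> fin_cases j <;> simp [T]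
    linear_combination htr
  rw [hm, hT, e_zero, h_zero, f_zero]
  simp
end

section
/- Let p be a prime, K a finite extension of ℚ_p, and O the ring of integers of K. Let R be a nonzero commutative O-algebra that is finitely generated as an O-module and whose Krull dimension is at least 1. Then there exists an O-algebra homomorphism from R to the integral closure of O in an algebraic closure of K. -/
/-- A nonzero prime ideal of `ℤ_[p]` contains `p`. -/
theorem PadicInt.natCast_mem_of_isPrime_of_ne_bot {p : ℕ} [Fact p.Prime] {I : Ideal ℤ_[p]}
    [I.IsPrime] (hI : I ≠ ⊥) : (p : ℤ_[p]) ∈ I := by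
  have hmax : I.IsMaximal := Ideal.IsPrime.isMaximal ‹_› hI
  rw [IsLocalRing.eq_maximalIdeal hmax, PadicInt.maximalIdeal_eq_span_p]
  exact Ideal.mem_span_singleton_self _

/-- A ring homomorphism to a domain of characteristic zero from a domain integral over
`ℤ_[p]` is injective. -/
theorem PadicInt.injective_of_isIntegral (p : ℕ) [Fact p.Prime] {O : Type*} [CommRing O]
    [IsDomain O] [Algebra ℤ_[p] O] [Algebra.IsIntegral ℤ_[p] O] {S : Type*} [CommRing S]
    [IsDomain S] [CharZero S] (f : O →+* S) : Function.Injective f := by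
  rw [RingHom.injective_iff_ker_eq_bot]
  refine Ideal.eq_bot_of_comap_eq_bot (R := ℤ_[p]) ?_
  by_contra h
  have := (RingHom.ker_isPrime f).comap (algebraMap ℤ_[p] O)
  have hp := PadicInt.natCast_mem_of_isPrime_of_ne_bot h
  simp [(Fact.out : p.Prime).ne_zero] at hp

/-- Let `K` be a finite extension of `ℚ_p` with ring of integers `O`
(the integral closure of `ℤ_p` in `K`).  If `R` is a nonzero commutative `O`-algebra which
is finitely generated as an `O`-module and has Krull dimension at least `1`, then there is
an `O`-algebra homomorphism from `R` to the integral closure of `O` in an algebraic closure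
of `K`. -/
theorem exists_point_of_finite_flat_dim_ge_one
    (p : ℕ) [Fact (Nat.Prime p)]
    (K : Type*) [Field K] [Algebra ℚ_[p] K] [FiniteDimensional ℚ_[p] K]
    (O : Type*) [CommRing O] [Algebra O K]
    [Algebra ℤ_[p] O] [Algebra ℤ_[p] K] [IsScalarTower ℤ_[p] O K]
    [IsIntegralClosure O ℤ_[p] K]
    [Algebra O (AlgebraicClosure K)] [IsScalarTower O K (AlgebraicClosure K)]
    (R : Type*) [CommRing R] [Nontrivial R] [Algebra O R] [Module.Finite O R]
    (hdim : 1 ≤ ringKrullDim R) :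
    Nonempty (R →ₐ[O] (integralClosure O (AlgebraicClosure K))) := by
  have hO : Function.Injective (algebraMap O K) :=
    IsIntegralClosure.algebraMap_injective O ℤ_[p] K
  have : IsDomain O := hO.isDomain (algebraMap O K)
  have : Algebra.IsIntegral ℤ_[p] O := IsIntegralClosure.isIntegral_algebra ℤ_[p] K
  have : CharZero K := charZero_of_injective_algebraMap (algebraMap ℚ_[p] K).injective
  have hΩ : Function.Injective (algebraMap O (AlgebraicClosure K)) :=
    PadicInt.injective_of_isIntegral p _
  have := Module.isTorsionFree_iff_algebraMap_injective.2 hΩ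
  obtain ⟨P, Q, hPQ⟩ : ∃ P Q : PrimeSpectrum R, P < Q :=
    Order.krullDim_pos_iff.1 (zero_lt_one.trans_le hdim)
  have hlt : (P.asIdeal.comap (algebraMap O R)).comap (algebraMap ℤ_[p] O) <
      (Q.asIdeal.comap (algebraMap O R)).comap (algebraMap ℤ_[p] O) :=
    Ideal.IsIntegral.comap_lt_comap (Ideal.IsIntegral.comap_lt_comap hPQ)
  have hbot : P.asIdeal.comap (algebraMap O R) = ⊥ := by
    refine Ideal.eq_bot_of_comap_eq_bot (R := ℤ_[p]) ?_
    by_contra h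
    have hmax := Ideal.IsPrime.isMaximal inferInstance h
    exact ((Q.2.comap _).comap _).ne_top (hmax.1.2 _ hlt)
  have : Module.IsTorsionFree O (R ⧸ P.asIdeal) := by
    rw [Module.isTorsionFree_iff_algebraMap_injective, RingHom.injective_iff_ker_eq_bot, ← hbot,
      IsScalarTower.algebraMap_eq O R (R ⧸ P.asIdeal), ← RingHom.comap_ker,
      Ideal.Quotient.algebraMap_eq, Ideal.mk_ker]
  let f : R →ₐ[O] AlgebraicClosure K :=
    (IsAlgClosed.lift (R := O) (S := R ⧸ P.asIdeal)).comp (Ideal.Quotient.mkₐ O P.asIdeal)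
  exact ⟨f.codRestrict _ fun x ↦ (Algebra.IsIntegral.isIntegral x).map f⟩
end
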